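/- In the simply typed lambda calculus, if there exists a term M such that Γ ⊢ M : τ, then there exists a term P that is β-normal and η-long such that Γ ⊢ P : τ. -/

import Mathlib

/-- Simple types over countably many base types. -/
inductive Ty : Type
  | base : ℕ → Ty
  | arrow : Ty → Ty → Ty
deriving DecidableEq

/-- Untyped λ-terms in de Bruijn representation (λ's carry their domain type). -/
inductive Tm : Type
  | var : ℕ → Tm
  | app : Tm → Tm → Tm
  | lam : Ty → Tm → Tm
deriving DecidableEq

/-- Typing judgment Γ ⊢ M : τ, with the context a list of types (de Bruijn). -/
inductive HasType : List Ty → Tm → Ty → Prop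
  | var {Γ : List Ty} {n : ℕ} {τ : Ty} :
      Γ[n]? = some τ → HasType Γ (.var n) τ
  | app {Γ : List Ty} {M N : Tm} {σ τ : Ty} :
      HasType Γ M (.arrow σ τ) → HasType Γ N σ → HasType Γ (.app M N) τ
  | lam {Γ : List Ty} {M : Tm} {σ τ : Ty} :
      HasType (σ :: Γ) M τ → HasType Γ (.lam σ M) (.arrow σ τ)

/-- A term is β-normal iff it contains no β-redex `(λx.M) N`. -/
def BetaNormal : Tm → Prop
  | .var _ => True
  | .app M N => (∀ σ B, M ≠ .lam σ B) ∧ BetaNormal M ∧ BetaNormal N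
  | .lam _ M => BetaNormal M

mutual
  /-- η-long (β-normal) forms of type τ under Γ: every subterm of
  function type is a λ-abstraction, and heads are fully applied. -/
  inductive EtaLong : List Ty → Tm → Ty → Prop
    | lam {Γ : List Ty} {M : Tm} {σ τ : Ty} :
        EtaLong (σ :: Γ) M τ → EtaLong Γ (.lam σ M) (.arrow σ τ)
    | ne {Γ : List Ty} {M : Tm} {b : ℕ} :
        EtaLongNeutral Γ M (.base b) → EtaLong Γ M (.base b)
  /-- Neutral (head-variable, fully applied along the way) η-long forms. -/
  inductive EtaLongNeutral : List Ty → Tm → Ty → Prop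
    | var {Γ : List Ty} {n : ℕ} {τ : Ty} :
        Γ[n]? = some τ → EtaLongNeutral Γ (.var n) τ
    | app {Γ : List Ty} {M N : Tm} {σ τ : Ty} :
        EtaLongNeutral Γ M (.arrow σ τ) → EtaLong Γ N σ →
        EtaLongNeutral Γ (.app M N) τ
end


mutual
  theorem EtaLong.hasType {Γ : List Ty} {M : Tm} {τ : Ty} :
      EtaLong Γ M τ → HasType Γ M τ
    | .lam h => .lam h.hasType
    | .ne h => h.hasType
  theorem EtaLongNeutral.hasType {Γ : List Ty} {M : Tm} {τ : Ty} :
      EtaLongNeutral Γ M τ → HasType Γ M τ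
    | .var h => .var h
    | .app h k => .app h.hasType k.hasType
end

theorem EtaLongNeutral.ne_lam {Γ : List Ty} {M : Tm} {τ : Ty}
    (h : EtaLongNeutral Γ M τ) (σ : Ty) (B : Tm) : M ≠ .lam σ B := by
  cases h <;> simp

mutual
  theorem EtaLong.betaNormal {Γ : List Ty} {M : Tm} {τ : Ty} :
      EtaLong Γ M τ → BetaNormal M
    | .lam h => h.betaNormal
    | .ne h => h.betaNormal
  theorem EtaLongNeutral.betaNormal {Γ : List Ty} {M : Tm} {τ : Ty} :
      EtaLongNeutral Γ M τ → BetaNormal M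
    | .var _ => trivial
    | .app h k => ⟨h.ne_lam, h.betaNormal, k.betaNormal⟩
end

mutual
  /-- Weakening for inhabitation by η-long forms. -/
  theorem EtaLong.weaken {Γ Δ : List Ty} {M : Tm} {τ : Ty} (hs : Γ ⊆ Δ) :
      EtaLong Γ M τ → ∃ P, EtaLong Δ P τ
    | .lam (σ := σ) h =>
      let ⟨_, hP⟩ := h.weaken (List.cons_subset_cons σ hs)
      ⟨_, .lam hP⟩
    | .ne h =>
      let ⟨_, hP⟩ := h.weaken hs
      ⟨_, .ne hP⟩
  /-- Weakening for inhabitation by neutral η-long forms. -/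
  theorem EtaLongNeutral.weaken {Γ Δ : List Ty} {M : Tm} {τ : Ty} (hs : Γ ⊆ Δ) :
      EtaLongNeutral Γ M τ → ∃ P, EtaLongNeutral Δ P τ
    | .var h =>
      let ⟨_, hn⟩ := List.mem_iff_getElem?.mp (hs (List.mem_of_getElem? h))
      ⟨_, .var hn⟩
    | .app h k =>
      let ⟨_, hP⟩ := h.weaken hs
      let ⟨_, hQ⟩ := k.weaken hs
      ⟨_, .app hP hQ⟩
end

/-- Forcing in the Kripke model whose worlds are contexts and in which a base type
is forced when it has an η-long inhabitant. -/
def Forces : List Ty → Ty → Prop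
  | Γ, .base b => ∃ P, EtaLong Γ P (.base b)
  | Γ, .arrow σ τ => ∀ Δ, Γ ⊆ Δ → Forces Δ σ → Forces Δ τ

theorem Forces.mono {Γ Δ : List Ty} {τ : Ty} (hs : Γ ⊆ Δ) (h : Forces Γ τ) :
    Forces Δ τ := by
  cases τ with
  | base b =>
    simp only [Forces] at h ⊢
    obtain ⟨P, hP⟩ := h
    exact hP.weaken hs
  | arrow σ τ =>
    simp only [Forces] at h ⊢
    exact fun E hE => h E (List.Subset.trans hs hE)

/-- Forced types have η-long inhabitants, and types with neutral inhabitants are forced. -/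
theorem forces_reify_reflect (τ : Ty) :
    (∀ Γ, Forces Γ τ → ∃ P, EtaLong Γ P τ) ∧
      ∀ Γ M, EtaLongNeutral Γ M τ → Forces Γ τ := by
  induction τ with
  | base b =>
    simp only [Forces]
    exact ⟨fun _ h => h, fun _ M h => ⟨M, .ne h⟩⟩
  | arrow σ τ ihσ ihτ =>
    simp only [Forces]
    refine ⟨fun Γ h => ?_, fun Γ M hM Δ hs hσ => ?_⟩
    · obtain ⟨P, hP⟩ := ihτ.1 _
        (h (σ :: Γ) (List.subset_cons_self σ Γ) (ihσ.2 _ (.var 0) (.var rfl)))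
      exact ⟨_, .lam hP⟩
    · obtain ⟨N, hN⟩ := ihσ.1 Δ hσ
      obtain ⟨P, hP⟩ := hM.weaken hs
      exact ihτ.2 Δ _ (.app hP hN)

/-- Soundness of typing for forcing. -/
theorem HasType.forces {Γ : List Ty} {M : Tm} {τ : Ty} (h : HasType Γ M τ) :
    ∀ Δ, (∀ σ ∈ Γ, Forces Δ σ) → Forces Δ τ := by
  induction h with
  | var h => exact fun Δ hΔ => hΔ _ (List.mem_of_getElem? h)
  | app _ _ ihM ihN =>
    intro Δ hΔ
    have hM := ihM Δ hΔ
    simp only [Forces] at hM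
    exact hM Δ (List.Subset.refl Δ) (ihN Δ hΔ)
  | lam _ ih =>
    intro Δ hΔ
    simp only [Forces]
    exact fun E hE hσ => ih E (List.forall_mem_cons.mpr ⟨hσ, fun ρ hρ => (hΔ ρ hρ).mono hE⟩)

/-- If Γ ⊢ M : τ for some term M, then there is a term P which is β-normal
and η-long with Γ ⊢ P : τ. -/
theorem exists_etaLong_betaNormal_proof (Γ : List Ty) (τ : Ty)
    (h : ∃ M : Tm, HasType Γ M τ) :
    ∃ P : Tm, HasType Γ P τ ∧ BetaNormal P ∧ EtaLong Γ P τ := by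
  obtain ⟨M, hM⟩ := h
  have hΓ : ∀ σ ∈ Γ, Forces Γ σ := fun σ hσ =>
    let ⟨_, hn⟩ := List.mem_iff_getElem?.mp hσ
    (forces_reify_reflect σ).2 Γ _ (.var hn)
  obtain ⟨P, hP⟩ := (forces_reify_reflect τ).1 Γ (hM.forces Γ hΓ)
  exact ⟨P, hP.hasType, hP.betaNormal, hP⟩
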